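/- Let L be a first-order language, T an L-theory, and φ(x,y) an L-formula that is stable in T. Then there is a single L-formula ψ(y,z), stable in T and with z a finite tuple of copies of the variable tuple y, such that for every model M ⊨ T, every set A ⊆ M^y with |A| ≥ 2, and every φ-type p over A, there is a ∈ A^z such that ψ(y,a) defines p (i.e. for all b ∈ A: M ⊨ ψ(b,a) ⟺ φ(x,b) ∈ p). -/

import Mathlib

open FirstOrder Language

universe u v

/-- `φ(x, y)` is stable in `T`: there is `n` such that no model of `T` contains an
order-witnessing ladder `(b_i, a_j)_{i,j < n}` for `φ`. -/
def FormulaStable {L : FirstOrder.Language.{u, v}} {α β : Type*} (T : L.Theory)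
    (φ : L.Formula (α ⊕ β)) : Prop :=
  ∃ n : ℕ, ∀ (N : Type (max u v)) [L.Structure N] [Nonempty N], N ⊨ T →
    ∀ (b : Fin n → α → N) (a : Fin n → β → N),
      ¬ ∀ i j : Fin n, (φ.Realize (Sum.elim (b i) (a j)) ↔ i ≤ j)

/-- `p` (given as the set of parameters `a ∈ A` with `φ(x,a) ∈ p`) is a (consistent,
complete) `φ`-type over `A`: every finite fragment of it is realized in `M`. -/
def IsPhiType {L : FirstOrder.Language.{u, v}} {α β : Type*} {M : Type (max u v)}
    [L.Structure M] (φ : L.Formula (α ⊕ β)) (A : Set (β → M)) (p : Set (β → M)) :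
    Prop :=
  p ⊆ A ∧ ∀ A₀ : Finset (β → M), ↑A₀ ⊆ A →
    ∃ b : α → M, ∀ a ∈ A₀, (φ.Realize (Sum.elim b a) ↔ a ∈ p)

section Combinatorics

variable {X Y : Type*}

/-- `P` and `Q` lie on opposite sides of the cut given by some `y`. -/
def Separated (r : X → Y → Prop) (P Q : Set X) : Prop :=
  ∃ y, ((∀ x ∈ P, r x y) ∧ ∀ x ∈ Q, ¬ r x y) ∨ ((∀ x ∈ P, ¬ r x y) ∧ ∀ x ∈ Q, r x y)

/-- `S` contains `d` pairwise separated subsets satisfying `F`. -/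
def HasPieces (r : X → Y → Prop) (F : Set X → Prop) (d : ℕ) (S : Set X) : Prop :=
  ∃ P : Fin d → Set X, (∀ i, P i ⊆ S) ∧ (∀ i, F (P i)) ∧
    ∀ i j, i ≠ j → Separated r (P i) (P j)

/-- The local rank of `S` with `m`-fold splitting is at least `k`. -/
def RankGE (r : X → Y → Prop) (m : ℕ) : ℕ → Set X → Prop
  | 0 => Set.Nonempty
  | k + 1 => HasPieces r (RankGE r m k) m

variable {r : X → Y → Prop}

lemma Separated.symm {P Q : Set X} : Separated r P Q → Separated r Q P := by
  rintro ⟨y, h | h⟩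
  · exact ⟨y, Or.inr ⟨h.2, h.1⟩⟩
  · exact ⟨y, Or.inl ⟨h.2, h.1⟩⟩

lemma Separated.mono {P P' Q Q' : Set X} (hP : P' ⊆ P) (hQ : Q' ⊆ Q) :
    Separated r P Q → Separated r P' Q' := by
  rintro ⟨y, h | h⟩
  · exact ⟨y, Or.inl ⟨fun x hx => h.1 x (hP hx), fun x hx => h.2 x (hQ hx)⟩⟩
  · exact ⟨y, Or.inr ⟨fun x hx => h.1 x (hP hx), fun x hx => h.2 x (hQ hx)⟩⟩

lemma HasPieces.mono {F : Set X → Prop} {d : ℕ} {S S' : Set X} (h : S ⊆ S') :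
    HasPieces r F d S → HasPieces r F d S' := by
  rintro ⟨P, hP, hF, hs⟩
  exact ⟨P, fun i => (hP i).trans h, hF, hs⟩

lemma HasPieces.cons {F : Set X → Prop} {d : ℕ} {S Q : Set X} {P : Fin d → Set X}
    (hP : ∀ i, P i ⊆ S) (hF : ∀ i, F (P i)) (hs : ∀ i j, i ≠ j → Separated r (P i) (P j))
    (hQS : Q ⊆ S) (hQ : F Q) (hQP : ∀ i, Separated r Q (P i)) :
    HasPieces r F (d + 1) S := by
  refine ⟨Fin.cons Q P, fun i => ?_, fun i => ?_, fun i j => ?_⟩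
  · cases i using Fin.cases <;> simp [hP, hQS]
  · cases i using Fin.cases <;> simp [hF, hQ]
  · cases i using Fin.cases <;> cases j using Fin.cases
    · simp
    · exact fun _ => by simpa using hQP _
    · exact fun _ => by simpa using (hQP _).symm
    · simpa using hs _ _

lemma RankGE.mono {m : ℕ} : ∀ {k : ℕ} {S S' : Set X}, S ⊆ S' →
    RankGE r m k S → RankGE r m k S'
  | 0, _, _, h => Set.Nonempty.mono h
  | _ + 1, _, _, h => HasPieces.mono h

lemma RankGE.anti {m m' : ℕ} (hm : m ≤ m') {k : ℕ} : ∀ {S : Set X},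
    RankGE r m' k S → RankGE r m k S := by
  induction k with
  | zero => exact id
  | succ k ih =>
    rintro S ⟨P, hP, hF, hs⟩
    exact ⟨fun i => P (Fin.castLE hm i), fun i => hP _, fun i => ih (hF _),
      fun i j hij => hs _ _ (by simpa using hij)⟩

lemma rankGE_of_hasPieces_one {m k : ℕ} {S : Set X}
    (h : RankGE r m k S) : HasPieces r (RankGE r m k) 1 S :=
  ⟨fun _ => S, fun _ => subset_rfl, fun _ => h, fun _ _ hij => (hij (Subsingleton.elim _ _)).elim⟩

/-- A set of large rank is not covered by few sets of small rank. -/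
lemma RankGE.exists_of_cover {q m k : ℕ} (hq : 0 < q) {S : Set X} {B : Fin q → Set X}
    (h : RankGE r (q * m) k S) (hB : ∀ x ∈ S, ∃ i, x ∈ B i) :
    ∃ i, RankGE r m k (S ∩ B i) := by
  induction k generalizing S with
  | zero =>
    obtain ⟨x, hx⟩ := h
    obtain ⟨i, hi⟩ := hB x hx
    exact ⟨i, x, hx, hi⟩
  | succ k ih =>
    obtain ⟨P, hP, hF, hs⟩ := h
    choose c hc using fun u => ih (hF u) (fun x hx => hB x (hP u hx))
    have : Nonempty (Fin q) := ⟨⟨0, hq⟩⟩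
    obtain ⟨i, hi⟩ := Fintype.exists_le_card_fiber_of_mul_le_card (n := m) c (by simp)
    obtain ⟨t, ht, htm⟩ := Finset.exists_subset_card_eq hi
    let e := t.orderEmbOfFin htm
    have he : ∀ a, c (e a) = i := fun a => by
      have := ht (t.orderEmbOfFin_mem htm a)
      simpa using this
    refine ⟨i, fun a => P (e a) ∩ B i, fun a => Set.inter_subset_inter_left _ (hP _),
      fun a => ?_, fun a b hab => ?_⟩
    · have := hc (e a)
      rwa [he a] at this
    · exact (hs _ _ (by simpa using hab)).mono Set.inter_subset_left Set.inter_subset_left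

/-- The cuts by elements of `V` form a binary tree of height `h` on `S`. -/
def HasTree (r : X → Y → Prop) : ℕ → Set X → Set Y → Prop
  | 0, S, _ => S.Nonempty
  | h + 1, S, V => ∃ y ∈ V, HasTree r h {x ∈ S | r x y} V ∧ HasTree r h {x ∈ S | ¬ r x y} V

lemma HasTree.mono {V : Set Y} {h : ℕ} : ∀ {S S' : Set X}, S ⊆ S' →
    HasTree r h S V → HasTree r h S' V := by
  induction h with
  | zero => exact fun h => Set.Nonempty.mono h
  | succ h ih =>
    rintro S S' hS ⟨y, hy, h1, h2⟩
    exact ⟨y, hy, ih (fun x hx => ⟨hS hx.1, hx.2⟩) h1, ih (fun x hx => ⟨hS hx.1, hx.2⟩) h2⟩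

lemma HasTree.nonempty {V : Set Y} {h : ℕ} : ∀ {S : Set X}, HasTree r h S V → S.Nonempty := by
  induction h with
  | zero => exact id
  | succ h ih =>
    rintro S ⟨y, hy, h1, h2⟩
    exact (ih h1).mono fun x hx => hx.1

lemma HasTree.split (g : ℕ) : ∀ (h₁ h₂ : ℕ), h₁ + h₂ = g → ∀ {S : Set X} {V V₁ V₂ : Set Y},
    V ⊆ V₁ ∪ V₂ → HasTree r g S V → HasTree r h₁ S V₁ ∨ HasTree r h₂ S V₂ := by
  induction g with
  | zero =>
    intro h₁ h₂ hg S V V₁ V₂ _ h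
    obtain rfl : h₁ = 0 := by omega
    exact Or.inl h
  | succ g ih =>
    intro h₁ h₂ hg S V V₁ V₂ hV h
    rcases h₁ with _ | h₁
    · exact Or.inl h.nonempty
    rcases h₂ with _ | h₂
    · exact Or.inr h.nonempty
    obtain ⟨y, hy, hp, hn⟩ := h
    rcases hV hy with hy | hy
    · rcases ih h₁ (h₂ + 1) (by omega) hV hp with hp | hp
      · rcases ih h₁ (h₂ + 1) (by omega) hV hn with hn | hn
        · exact Or.inl ⟨y, hy, hp, hn⟩
        · exact Or.inr (hn.mono fun x hx => hx.1)
      · exact Or.inr (hp.mono fun x hx => hx.1)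
    · rcases ih (h₁ + 1) h₂ (by omega) hV hp with hp | hp
      · exact Or.inl (hp.mono fun x hx => hx.1)
      · rcases ih (h₁ + 1) h₂ (by omega) hV hn with hn | hn
        · exact Or.inl (hn.mono fun x hx => hx.1)
        · exact Or.inr ⟨y, hy, hp, hn⟩

/-- A height of binary trees that forces ladders of length `n`. -/
def treeHeight : ℕ → ℕ
  | 0 => 0
  | n + 1 => (treeHeight n + 1) + (treeHeight n + 1)

/-- Tall trees contain long ladders. -/
lemma HasTree.exists_ladder (n : ℕ) : ∀ {S : Set X} {V : Set Y}, HasTree r (treeHeight n) S V →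
    ∃ (b : Fin (n + 1) → X) (a : Fin n → Y), (∀ i, b i ∈ S) ∧ (∀ i, a i ∈ V) ∧
      ∀ i j, r (b i) (a j) ↔ i ≤ j.castSucc := by
  induction n with
  | zero =>
    rintro S V ⟨x, hx⟩
    exact ⟨fun _ => x, Fin.elim0, fun _ => hx, fun i => i.elim0, fun _ j => j.elim0⟩
  | succ n ih =>
    intro S V h
    obtain ⟨x, hx⟩ := h.nonempty
    have hV : V ⊆ {y ∈ V | r x y} ∪ {y ∈ V | ¬ r x y} := fun y hy => by
      by_cases hr : r x y
      · exact Or.inl ⟨hy, hr⟩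
      · exact Or.inr ⟨hy, hr⟩
    rcases h.split _ _ _ rfl hV with ⟨y, hy, -, hn⟩ | ⟨y, hy, hp, -⟩
    · obtain ⟨b, a, hb, ha, hl⟩ := ih hn
      refine ⟨Fin.cons x b, Fin.cons y a, fun i => ?_, fun i => ?_, fun i j => ?_⟩
      · cases i using Fin.cases
        · simpa
        · simpa using (hb _).1
      · cases i using Fin.cases
        · simpa using hy.1
        · simpa using (ha _).1
      · cases i using Fin.cases <;> cases j using Fin.cases
        · simpa using hy.2
        · simpa using (ha _).2
        · simpa using (hb _).2
        · simpa [← Fin.succ_castSucc] using hl _ _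
    · obtain ⟨b, a, hb, ha, hl⟩ := ih hp
      refine ⟨Fin.snoc b x, Fin.snoc a y, fun i => ?_, fun i => ?_, fun i j => ?_⟩
      · cases i using Fin.lastCases
        · simpa
        · simpa using (hb _).1
      · cases i using Fin.lastCases
        · simpa using hy.1
        · simpa using (ha _).1
      · cases i using Fin.lastCases <;> cases j using Fin.lastCases
        · simpa [Fin.le_def] using hy.2
        · rename_i j
          simp [Fin.le_def, (ha j).2]
        · rename_i i
          simpa [Fin.le_def, (hb i).2] using Nat.lt_succ_iff.1 i.2
        · simpa using hl _ _

lemma RankGE.hasTree {m : ℕ} (hm : 2 ≤ m) {k : ℕ} : ∀ {S : Set X}, RankGE r m k S →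
    HasTree r k S Set.univ := by
  induction k with
  | zero => exact id
  | succ k ih =>
    rintro S ⟨P, hP, hF, hs⟩
    obtain ⟨y, h | h⟩ := hs ⟨0, by omega⟩ ⟨1, by omega⟩ (by simp)
    · exact ⟨y, trivial, (ih (hF _)).mono fun x hx => ⟨hP _ hx, h.1 x hx⟩,
        (ih (hF _)).mono fun x hx => ⟨hP _ hx, h.2 x hx⟩⟩
    · exact ⟨y, trivial, (ih (hF _)).mono fun x hx => ⟨hP _ hx, h.2 x hx⟩,
        (ih (hF _)).mono fun x hx => ⟨hP _ hx, h.1 x hx⟩⟩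

/-- The relation `r` has no ladder of length `n`. -/
def NoLadder (r : X → Y → Prop) (n : ℕ) : Prop :=
  ∀ (b : Fin n → X) (a : Fin n → Y), ¬ ∀ i j, (r (b i) (a j) ↔ i ≤ j)

lemma NoLadder.not_rankGE {n : ℕ} (hn : NoLadder r n) {m : ℕ} (hm : 2 ≤ m) (S : Set X) :
    ¬ RankGE r m (treeHeight n) S := by
  intro h
  obtain ⟨b, a, -, -, hl⟩ := (h.hasTree hm).exists_ladder
  exact hn (fun i => b i.castSucc) a fun i j => by simpa using hl i.castSucc j

/-- Ramsey's theorem for pairs and finitely many colours. -/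
lemma exists_homogeneous {d : ℕ} (s : ℕ) : ∀ (f : Fin d → ℕ), ∑ l, f l = s → ∃ N : ℕ,
    ∀ {κ : Type} [LinearOrder κ] (s : Finset κ), N ≤ s.card → ∀ c : κ → κ → Fin d,
      ∃ l, ∃ t ⊆ s, t.card = f l ∧ ∀ i ∈ t, ∀ j ∈ t, i < j → c i j = l := by
  classical
  induction s with
  | zero =>
    intro f hf
    refine ⟨1, fun s hs c => ?_⟩
    obtain ⟨v, -⟩ := Finset.card_pos.1 hs
    have : f (c v v) = 0 := Finset.sum_eq_zero_iff.1 hf _ (Finset.mem_univ _)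
    exact ⟨c v v, ∅, by simp, by simp [this], by simp⟩
  | succ n ih =>
    intro f hf
    by_cases h0 : ∃ l, f l = 0
    · obtain ⟨l, hl⟩ := h0
      exact ⟨0, fun s _ c => ⟨l, ∅, by simp, by simp [hl], by simp⟩⟩
    push Not at h0
    have hsum : ∀ l, ∑ l', Function.update f l (f l - 1) l' = n := fun l => by
      have h1 := Finset.sum_update_of_mem (Finset.mem_univ l) f (f l - 1)
      have h2 := Finset.add_sum_erase Finset.univ f (Finset.mem_univ l)
      have h3 := h0 l
      rw [Finset.sdiff_singleton_eq_erase] at h1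
      omega
    choose N hN using fun l => ih _ (hsum l)
    refine ⟨1 + ∑ l, N l, fun s hs c => ?_⟩
    have hne : s.Nonempty := Finset.card_pos.1 (by omega)
    set v := s.min' hne with hv
    have hvs : v ∈ s := s.min'_mem hne
    have hcard : ∑ l, N l ≤ (s.erase v).card := by
      rw [Finset.card_erase_of_mem hvs]; omega
    obtain ⟨l, hl⟩ : ∃ l, N l ≤ ((s.erase v).filter fun i => c v i = l).card := by
      by_contra! hlt
      have h1 := Finset.card_eq_sum_card_fiberwise (f := c v) (s := s.erase v)
        (t := Finset.univ) (by intro x _; simp)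
      have h2 := Finset.sum_lt_sum_of_nonempty (s := Finset.univ) ⟨c v v, Finset.mem_univ _⟩
        (fun l _ => hlt l)
      omega
    obtain ⟨l', t, ht, htc, hth⟩ := hN l _ hl c
    by_cases hll : l' = l
    · subst hll
      have hvt : v ∉ t := fun h => by simpa using ht h
      refine ⟨l', insert v t, ?_, ?_, ?_⟩
      · intro x hx
        rcases Finset.mem_insert.1 hx with rfl | hx
        · exact hvs
        · exact Finset.mem_of_mem_erase (Finset.mem_filter.1 (ht hx)).1
      · rw [Finset.card_insert_of_notMem hvt, htc]
        have := h0 l'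
        simp
        omega
      · intro i hi j hj hij
        rcases Finset.mem_insert.1 hj with rfl | hj
        · rcases Finset.mem_insert.1 hi with h | hi
          · exact (hij.ne h).elim
          · have := s.min'_le i (Finset.mem_of_mem_erase (Finset.mem_filter.1 (ht hi)).1)
            exact (not_lt.2 this hij).elim
        · rcases Finset.mem_insert.1 hi with rfl | hi
          · exact (Finset.mem_filter.1 (ht hj)).2
          · exact hth i hi j hj hij
    · refine ⟨l', t, fun x hx => Finset.mem_of_mem_erase (Finset.mem_filter.1 (ht hx)).1, ?_, hth⟩
      rw [htc, Function.update_of_ne hll]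

/-- On any `q` cuts, the elements `y` for which `S` is generically contained in `r · y` are those
related to all members of a suitable `d`-tuple. -/
lemma exists_points {m k d q : ℕ} (hq : 2 ≤ q) {S : Set X}
    (h₁ : HasPieces r (RankGE r (q * m) k) d S) (h₂ : ¬ HasPieces r (RankGE r m k) (d + 1) S)
    (y : Fin q → Y) :
    ∃ b : Fin d → X, ∀ i,
      ¬ RankGE r m k {x ∈ S | ¬ r x (y i)} ↔ ∀ l, r (b l) (y i) := by
  obtain ⟨P, hP, hF, hs⟩ := h₁
  have hF' : ∀ l, RankGE r m k (P l) := fun l => (hF l).anti (Nat.le_mul_of_pos_left m (by omega))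
  have hsep : ∀ l y, ¬ (RankGE r m k {x ∈ P l | r x y} ∧ RankGE r m k {x ∈ P l | ¬ r x y}) := by
    rintro l y ⟨hp, hn⟩
    refine h₂ (HasPieces.cons (Q := {x ∈ P l | ¬ r x y})
      (P := Function.update P l {x ∈ P l | r x y}) (fun i => ?_) (fun i => ?_) (fun i j hij => ?_)
      (fun x hx => hP _ hx.1) hn (fun i => ?_))
    · by_cases h : i = l
      · subst h; rw [Function.update_self]; exact fun x hx => hP i hx.1
      · simpa [h] using hP i
    · by_cases h : i = l
      · subst h; simpa using hp
      · simpa [h] using hF' i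
    · refine (hs i j hij).mono ?_ ?_
      · by_cases h : i = l
        · subst h; simp
        · simp [h]
      · by_cases h : j = l
        · subst h; simp
        · simp [h]
    · by_cases h : i = l
      · subst h
        exact ⟨y, Or.inr ⟨fun x hx => hx.2, by simp⟩⟩
      · simpa [h] using (hs l i (Ne.symm h)).mono (fun x hx => hx.1) subset_rfl
  have hor : ∀ l y, RankGE r m k {x ∈ P l | r x y} ∨ RankGE r m k {x ∈ P l | ¬ r x y} := by
    intro l y
    obtain ⟨i, hi⟩ := (hF l).exists_of_cover (by omega)
      (B := fun i : Fin q => if i.1 = 0 then {x | r x y} else {x | ¬ r x y}) (fun x _ => by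
        by_cases hr : r x y
        · exact ⟨⟨0, by omega⟩, by simpa⟩
        · exact ⟨⟨1, by omega⟩, by simpa⟩)
    by_cases h : i.1 = 0
    · exact Or.inl (hi.mono fun x hx => ⟨hx.1, by simpa [h] using hx.2⟩)
    · exact Or.inr (hi.mono fun x hx => ⟨hx.1, by simpa [h] using hx.2⟩)
  have hb : ∀ l, ∃ b ∈ P l, ∀ i, r b (y i) ↔ ¬ RankGE r m k {x ∈ P l | ¬ r x (y i)} := by
    intro l
    by_contra! hcon
    obtain ⟨i, hi⟩ := (hF l).exists_of_cover (by omega)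
      (B := fun i : Fin q => {x | ¬ (r x (y i) ↔ ¬ RankGE r m k {x ∈ P l | ¬ r x (y i)})})
      (fun x hx => by
        obtain ⟨i, hi⟩ := hcon x hx
        refine ⟨i, ?_⟩
        simp only [Set.mem_ofPred_eq]
        tauto)
    by_cases h : RankGE r m k {x ∈ P l | ¬ r x (y i)}
    · exact hsep l (y i) ⟨hi.mono fun x hx => ⟨hx.1, by have := hx.2; simp_all⟩, h⟩
    · exact h (hi.mono fun x hx => ⟨hx.1, by have := hx.2; simp_all⟩)
  choose b hbP hb using hb
  refine ⟨b, fun i => ?_⟩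
  simp only [hb]
  constructor
  · exact fun h l h' => h (h'.mono fun x hx => ⟨hP _ hx.1, hx.2⟩)
  · intro h h'
    refine h₂ (HasPieces.cons (Q := {x ∈ S | ¬ r x (y i)})
      (P := fun l => {x ∈ P l | r x (y i)}) (fun l x hx => hP _ hx.1)
      (fun l => (hor l (y i)).resolve_right (h l))
      (fun l l' hll => (hs l l' hll).mono (fun x hx => hx.1) (fun x hx => hx.1))
      (fun x hx => hx.1) h' (fun l => ⟨y i, Or.inr ⟨fun x hx => hx.2, fun x hx => hx.2⟩⟩))

/-- A length of ladders which generic cuts by sets of multiplicity `d` cannot attain. -/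
lemma exists_generic_noLadder (n d : ℕ) : ∃ q, 2 ≤ q ∧ ∀ {X Y : Type*} {r : X → Y → Prop},
    NoLadder r n → ∀ {m k : ℕ} (y : Fin q → Y) (S : Fin q → Set X),
      (∀ j, HasPieces r (RankGE r (q * m) k) d (S j)) →
      (∀ j, ¬ HasPieces r (RankGE r m k) (d + 1) (S j)) →
      ¬ ∀ i j, (¬ RankGE r m k {x ∈ S j | ¬ r x (y i)} ↔ i ≤ j) := by
  obtain ⟨N, hN⟩ := exists_homogeneous (d := d) _ (fun _ => n) rfl
  refine ⟨max N 2, le_max_right _ _, fun {X Y r} hr {m k} y S h₁ h₂ hl => ?_⟩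
  choose b hb using fun j => exists_points (le_max_right _ _) (h₁ j) (h₂ j) y
  have hc : ∀ j i, ∃ l, j < i → ¬ r (b j l) (y i) := fun j i => by
    by_cases hij : j < i
    · have := (hb j i).not.1 (by rw [hl]; exact not_le.2 hij)
      push Not at this
      exact this.imp fun l hl _ => hl
    · have h0 := (hb ⟨0, by simp⟩ ⟨1, by simp⟩).not.1 (by rw [hl]; simp [Fin.le_def])
      push Not at h0
      exact h0.imp fun l _ h => (hij h).elim
  choose c hc using hc
  obtain ⟨l, t, -, htc, ht⟩ := hN (Finset.univ : Finset (Fin (max N 2))) (by simp) c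
  let e := t.orderEmbOfFin htc
  refine hr (fun i => b (e i.rev) l) (fun j => y (e j.rev)) fun i j => ?_
  rcases le_or_gt i j with hij | hij
  · have : e j.rev ≤ e i.rev := e.monotone (Fin.rev_le_rev.2 hij)
    simp only [hij, iff_true]
    exact (hb _ _).1 ((hl _ _).2 this) l
  · have : e i.rev < e j.rev := e.strictMono (Fin.rev_lt_rev.2 hij)
    simp only [not_le.2 hij, iff_false]
    have h := hc _ _ this
    rwa [ht _ (t.orderEmbOfFin_mem htc _) _ (t.orderEmbOfFin_mem htc _) this] at h

/-- Pieces may be taken to be finite intersections of cuts and their complements. -/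
lemma hasPieces_iff_exists_cuts [Nonempty Y] {F : Set X → Prop}
    (hF : ∀ {S S'}, S ⊆ S' → F S → F S') {d : ℕ} {S : Set X} :
    HasPieces r F d S ↔ ∃ (e : Fin d → Fin d → Bool) (y : Fin d × Fin d → Y), ∀ i,
      F {x | x ∈ S ∧ ∀ j, (i < j → (r x (y (i, j)) ↔ e i j = true)) ∧
        (j < i → (r x (y (j, i)) ↔ e j i = false))} := by
  constructor
  · rintro ⟨P, hP, hPF, hs⟩
    have h : ∀ i j, ∃ (y : Y) (e : Bool), i < j →
        (∀ x ∈ P i, (r x y ↔ e = true)) ∧ ∀ x ∈ P j, (r x y ↔ e = false) := by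
      intro i j
      by_cases hij : i < j
      · obtain ⟨y, h | h⟩ := hs i j hij.ne
        · exact ⟨y, true, fun _ => ⟨by simpa using h.1, by simpa using h.2⟩⟩
        · exact ⟨y, false, fun _ => ⟨by simpa using h.1, by simpa using h.2⟩⟩
      · exact ⟨Classical.arbitrary Y, true, fun h => (hij h).elim⟩
    choose y e h using h
    exact ⟨e, fun p => y p.1 p.2, fun i => hF (fun x hx => ⟨hP i hx, fun j =>
      ⟨fun hij => (h i j hij).1 x hx, fun hji => (h j i hji).2 x hx⟩⟩) (hPF i)⟩
  · rintro ⟨e, y, h⟩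
    refine ⟨_, fun i x hx => hx.1, h, ?_⟩
    have hlt : ∀ i j : Fin d, i < j → Separated r
        {x | x ∈ S ∧ ∀ j, (i < j → (r x (y (i, j)) ↔ e i j = true)) ∧
          (j < i → (r x (y (j, i)) ↔ e j i = false))}
        {x | x ∈ S ∧ ∀ i, (j < i → (r x (y (j, i)) ↔ e j i = true)) ∧
          (i < j → (r x (y (i, j)) ↔ e i j = false))} := by
      intro i j hij
      refine ⟨y (i, j), ?_⟩
      cases he : e i j
      · exact Or.inr ⟨fun x hx => by simpa [he] using (hx.2 j).1 hij,
          fun x hx => by simpa [he] using (hx.2 i).2 hij⟩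
      · exact Or.inl ⟨fun x hx => by simpa [he] using (hx.2 j).1 hij,
          fun x hx => by simpa [he] using (hx.2 i).2 hij⟩
    intro i j hij
    rcases lt_or_gt_of_ne hij with hij | hij
    · exact hlt i j hij
    · exact (hlt j i hij).symm

end Combinatorics

section Definability

variable {L : FirstOrder.Language.{u, v}} {nx ny : ℕ}

/-- The relation defined by `φ(x, y)` in `M`. -/
def rel {α β : Type*} (φ : L.Formula (α ⊕ β)) (M : Type*) [L.Structure M] (x : α → M)
    (y : β → M) : Prop :=
  φ.Realize (Sum.elim x y)

lemma exists_formula_hasPieces (φ : L.Formula (Fin nx ⊕ Fin ny))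
    (F : ∀ (M : Type (max u v)) [L.Structure M], Set (Fin nx → M) → Prop)
    (hmono : ∀ (M : Type (max u v)) [L.Structure M] {S S' : Set (Fin nx → M)},
      S ⊆ S' → F M S → F M S')
    (hF : ∀ {γ : Type} (θ : L.Formula (Fin nx ⊕ γ)), ∃ χ : L.Formula γ,
      ∀ (M : Type (max u v)) [L.Structure M] [Nonempty M] (z : γ → M),
        χ.Realize z ↔ F M {x | θ.Realize (Sum.elim x z)})
    (d : ℕ) {γ : Type} (θ : L.Formula (Fin nx ⊕ γ)) :
    ∃ χ : L.Formula γ, ∀ (M : Type (max u v)) [L.Structure M] [Nonempty M] (z : γ → M),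
      χ.Realize z ↔ HasPieces (rel φ M) (F M) d {x | θ.Realize (Sum.elim x z)} := by
  let ξ (p : Fin d × Fin d) : L.Formula (Fin nx ⊕ (γ ⊕ (Fin d × Fin d) × Fin ny)) :=
    φ.relabel (Sum.map id fun s => Sum.inr (p, s))
  let cut (e : Fin d → Fin d → Bool) (i j : Fin d) :
      L.Formula (Fin nx ⊕ (γ ⊕ (Fin d × Fin d) × Fin ny)) :=
    if i < j then (if e i j then ξ (i, j) else (ξ (i, j)).not)
    else if j < i then (if e j i then (ξ (j, i)).not else ξ (j, i)) else ⊤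
  have hcut : ∀ (M : Type (max u v)) [L.Structure M] (e i j) (x : Fin nx → M) (z : γ → M)
      (y : (Fin d × Fin d) × Fin ny → M),
      (cut e i j).Realize (Sum.elim x (Sum.elim z y)) ↔
        ((i < j → (rel φ M x (fun s => y ((i, j), s)) ↔ e i j = true)) ∧
        (j < i → (rel φ M x (fun s => y ((j, i), s)) ↔ e j i = false))) := by
    intro M _ e i j x z y
    have hξ : ∀ p, (ξ p).Realize (Sum.elim x (Sum.elim z y)) ↔
        rel φ M x (fun s => y (p, s)) := fun p => by
      simp only [ξ, rel, Formula.realize_relabel, Sum.elim_comp_map, Function.comp_id]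
      rfl
    rcases lt_trichotomy i j with hij | rfl | hij
    · cases he : e i j <;> simp [cut, hij, hij.not_gt, he, hξ]
    · simp [cut]
    · cases he : e j i <;> simp [cut, hij, hij.not_gt, he, hξ]
  let θ' (e : Fin d → Fin d → Bool) (i : Fin d) :
      L.Formula (Fin nx ⊕ (γ ⊕ (Fin d × Fin d) × Fin ny)) :=
    θ.relabel (Sum.map id Sum.inl) ⊓ Formula.iInf (cut e i)
  choose χ hχ using fun e i => hF (θ' e i)
  refine ⟨Formula.iSup fun e => (Formula.iInf (χ e)).iExs _, fun M _ _ z => ?_⟩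
  rw [hasPieces_iff_exists_cuts (hmono M)]
  simp only [Formula.realize_iSup, Formula.realize_iExs, Formula.realize_iInf, hχ]
  refine exists_congr fun e => (Equiv.curry (Fin d × Fin d) (Fin ny) M).exists_congr fun y => ?_
  refine forall_congr' fun i => ?_
  refine iff_of_eq (congrArg (F M) ?_)
  ext x
  simp only [θ', Set.mem_ofPred_eq, Formula.realize_inf, Formula.realize_iInf, hcut,
    Formula.realize_relabel, Sum.elim_comp_map, Function.comp_id, Sum.elim_comp_inl]
  rfl

lemma exists_formula_rankGE (φ : L.Formula (Fin nx ⊕ Fin ny)) (m k : ℕ) {γ : Type}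
    (θ : L.Formula (Fin nx ⊕ γ)) :
    ∃ χ : L.Formula γ, ∀ (M : Type (max u v)) [L.Structure M] [Nonempty M] (z : γ → M),
      χ.Realize z ↔ RankGE (rel φ M) m k {x | θ.Realize (Sum.elim x z)} := by
  induction k generalizing γ with
  | zero =>
    refine ⟨(θ.relabel Sum.swap).iExs (Fin nx), fun M _ _ z => ?_⟩
    simp only [Formula.realize_iExs, Formula.realize_relabel, Sum.elim_swap]
    rfl
  | succ k ih =>
    exact exists_formula_hasPieces φ (fun M _ => RankGE (rel φ M) m k)
      (fun M _ _ _ h => RankGE.mono h) ih m θ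

end Definability

section Uniformity

variable {L : FirstOrder.Language.{u, v}} {T : L.Theory}

lemma FormulaStable.relabel {α β γ : Type*} {ψ : L.Formula (α ⊕ β)} (h : FormulaStable T ψ)
    (g : β → γ) : FormulaStable T (ψ.relabel (Sum.map id g)) := by
  obtain ⟨n, hn⟩ := h
  refine ⟨n, fun N _ _ hN b a hl => hn N hN b (fun j => a j ∘ g) fun i j => ?_⟩
  simpa [Formula.realize_relabel, Sum.elim_comp_map] using hl i j

/-- Stability is preserved by a case distinction on the parameters. -/
lemma FormulaStable.cases {α β : Type*} {ψ₁ ψ₂ : L.Formula (α ⊕ β)} (h₁ : FormulaStable T ψ₁)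
    (h₂ : FormulaStable T ψ₂) (δ : L.Formula β) :
    FormulaStable T
      ((δ.relabel Sum.inr ⊓ ψ₁) ⊔ ((δ.relabel Sum.inr : L.Formula (α ⊕ β)).not ⊓ ψ₂)) := by
  classical
  obtain ⟨n₁, hn₁⟩ := h₁
  obtain ⟨n₂, hn₂⟩ := h₂
  refine ⟨n₁ + n₂, fun N _ _ hN b a hl => ?_⟩
  simp only [Formula.realize_sup, Formula.realize_inf, Formula.realize_not,
    Formula.realize_relabel, Sum.elim_comp_inr] at hl
  have hcard := Finset.card_filter_add_card_filter_not (s := (Finset.univ : Finset (Fin (n₁ + n₂))))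
    (fun j => δ.Realize (a j))
  rw [Finset.card_univ, Fintype.card_fin] at hcard
  rcases le_or_gt n₁ (Finset.univ.filter fun j => δ.Realize (a j)).card with h | h
  · obtain ⟨t, ht, htc⟩ := Finset.exists_subset_card_eq h
    let e := t.orderEmbOfFin htc
    refine hn₁ N hN (b ∘ e) (a ∘ e) fun i j => ?_
    have hj := (Finset.mem_filter.1 (ht (t.orderEmbOfFin_mem htc j))).2
    rw [← e.le_iff_le, ← hl]
    simp [e, hj]
  · obtain ⟨t, ht, htc⟩ := Finset.exists_subset_card_eq
      (show n₂ ≤ (Finset.univ.filter fun j => ¬ δ.Realize (a j)).card by omega)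
    let e := t.orderEmbOfFin htc
    refine hn₂ N hN (b ∘ e) (a ∘ e) fun i j => ?_
    have hj := (Finset.mem_filter.1 (ht (t.orderEmbOfFin_mem htc j))).2
    rw [← e.le_iff_le, ← hl]
    simp [e, hj]

variable {nx ny : ℕ} {φ : L.Formula (Fin nx ⊕ Fin ny)}

/-- A single stable formula defines all `φ`-types `p` over sets `A` for which `C` holds. -/
def UniformlyDefinable (T : L.Theory) (φ : L.Formula (Fin nx ⊕ Fin ny))
    (C : ∀ (M : Type (max u v)) [L.Structure M], Set (Fin ny → M) → Set (Fin ny → M) → Prop) :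
    Prop :=
  ∃ (ι : Type) (_ : Finite ι) (ψ : L.Formula (Fin ny ⊕ (ι × Fin ny))), FormulaStable T ψ ∧
    ∀ (M : Type (max u v)) [L.Structure M] [Nonempty M], M ⊨ T →
      ∀ A : Set (Fin ny → M), A.Nontrivial → ∀ p : Set (Fin ny → M), IsPhiType φ A p → C M A p →
        ∃ c : ι → Fin ny → M, (∀ i, c i ∈ A) ∧
          ∀ a ∈ A, (ψ.Realize (Sum.elim a fun iz => c iz.1 iz.2) ↔ a ∈ p)

variable {C C₁ C₂ : ∀ (M : Type (max u v)) [L.Structure M],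
  Set (Fin ny → M) → Set (Fin ny → M) → Prop}

lemma UniformlyDefinable.of_imp (h : UniformlyDefinable T φ C₁)
    (hC : ∀ (M : Type (max u v)) [L.Structure M] (A p : Set (Fin ny → M)),
      IsPhiType φ A p → C M A p → C₁ M A p) : UniformlyDefinable T φ C := by
  obtain ⟨ι, hι, ψ, hψ, hdef⟩ := h
  exact ⟨ι, hι, ψ, hψ, fun M _ _ hM A hA p hp hc => hdef M hM A hA p hp (hC M A p hp hc)⟩

lemma UniformlyDefinable.of_false
    (hC : ∀ (M : Type (max u v)) [L.Structure M] (A p : Set (Fin ny → M)),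
      IsPhiType φ A p → ¬ C M A p) : UniformlyDefinable T φ C :=
  ⟨Empty, inferInstance, ⊥, ⟨1, fun N _ _ _ b a h => by simpa using h 0 0⟩,
    fun M _ _ _ A _ p hp hc => (hC M A p hp hc).elim⟩

lemma UniformlyDefinable.or (h₁ : UniformlyDefinable T φ C₁) (h₂ : UniformlyDefinable T φ C₂) :
    UniformlyDefinable T φ fun M _ A p => C₁ M A p ∨ C₂ M A p := by
  obtain ⟨ι₁, hι₁, ψ₁, hψ₁, hdef₁⟩ := h₁
  obtain ⟨ι₂, hι₂, ψ₂, hψ₂, hdef₂⟩ := h₂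
  let g₁ : ι₁ × Fin ny → ((ι₁ ⊕ ι₂) ⊕ Bool) × Fin ny := Prod.map (Sum.inl ∘ Sum.inl) id
  let g₂ : ι₂ × Fin ny → ((ι₁ ⊕ ι₂) ⊕ Bool) × Fin ny := Prod.map (Sum.inl ∘ Sum.inr) id
  let δ : L.Formula (((ι₁ ⊕ ι₂) ⊕ Bool) × Fin ny) := Formula.iInf fun s : Fin ny =>
    Term.equal (Term.var (Sum.inr true, s)) (Term.var (Sum.inr false, s))
  refine ⟨(ι₁ ⊕ ι₂) ⊕ Bool, inferInstance, _, (hψ₁.relabel g₁).cases (hψ₂.relabel g₂) δ,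
    fun M _ _ hM A hA p hp hc => ?_⟩
  obtain ⟨a₀, ha₀, a₁, ha₁, hne⟩ := hA
  have hδ : ∀ c : (ι₁ ⊕ ι₂) ⊕ Bool → Fin ny → M,
      δ.Realize (fun iz => c iz.1 iz.2) ↔ c (Sum.inr true) = c (Sum.inr false) := fun c => by
    simp [δ, Formula.realize_equal, funext_iff]
  rcases hc with hc | hc
  · obtain ⟨c, hcA, hc⟩ := hdef₁ M hM A ⟨a₀, ha₀, a₁, ha₁, hne⟩ p hp hc
    let c' : (ι₁ ⊕ ι₂) ⊕ Bool → Fin ny → M := Sum.elim (Sum.elim c fun _ => a₀) fun _ => a₀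
    refine ⟨c', ?_, fun a ha => ?_⟩
    · rintro ((i | i) | i) <;> simp [c', hcA, ha₀]
    · rw [← hc a ha]
      have : (fun iz : ((ι₁ ⊕ ι₂) ⊕ Bool) × Fin ny => c' iz.1 iz.2) ∘ g₁ =
        fun iz => c iz.1 iz.2 := rfl
      simp only [Formula.realize_sup, Formula.realize_inf, Formula.realize_not,
        Formula.realize_relabel, Sum.elim_comp_inr, hδ, Sum.elim_comp_map, this]
      simp [c']
  · obtain ⟨c, hcA, hc⟩ := hdef₂ M hM A ⟨a₀, ha₀, a₁, ha₁, hne⟩ p hp hc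
    let c' : (ι₁ ⊕ ι₂) ⊕ Bool → Fin ny → M :=
      Sum.elim (Sum.elim (fun _ => a₀) c) fun i => if i then a₀ else a₁
    refine ⟨c', ?_, fun a ha => ?_⟩
    · rintro ((i | i) | (i | i)) <;> simp [c', hcA, ha₀, ha₁]
    · rw [← hc a ha]
      have : (fun iz : ((ι₁ ⊕ ι₂) ⊕ Bool) × Fin ny => c' iz.1 iz.2) ∘ g₂ =
        fun iz => c iz.1 iz.2 := rfl
      simp only [Formula.realize_sup, Formula.realize_inf, Formula.realize_not,
        Formula.realize_relabel, Sum.elim_comp_inr, hδ, Sum.elim_comp_map, this]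
      simp [c', hne]

end Uniformity

section Fragments

variable {L : FirstOrder.Language.{u, v}} {T : L.Theory} {nx ny : ℕ}
  {φ : L.Formula (Fin nx ⊕ Fin ny)}

/-- `S` belongs to the filter generated by the `φ`-type `p` over `A`. -/
def IsFragment {M : Type*} [L.Structure M] (φ : L.Formula (Fin nx ⊕ Fin ny))
    (A p : Set (Fin ny → M)) (S : Set (Fin nx → M)) : Prop :=
  ∃ A₀ : Finset (Fin ny → M), ↑A₀ ⊆ A ∧ ∀ b, (∀ a ∈ A₀, (rel φ M b a ↔ a ∈ p)) → b ∈ S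

/-- The set defined by `θ(x, w)`. -/
def solutions {ι : Type} {M : Type*} [L.Structure M] (θ : L.Formula (Fin nx ⊕ (ι × Fin ny)))
    (w : ι → Fin ny → M) : Set (Fin nx → M) :=
  {x | θ.Realize (Sum.elim x fun iz => w iz.1 iz.2)}

lemma IsFragment.nonempty {M : Type (max u v)} [L.Structure M] {A p : Set (Fin ny → M)}
    {S : Set (Fin nx → M)} (h : IsFragment φ A p S) (hp : IsPhiType φ A p) : S.Nonempty := by
  obtain ⟨A₀, hA₀, h⟩ := h
  obtain ⟨b, hb⟩ := hp.2 A₀ hA₀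
  exact ⟨b, h b hb⟩

lemma IsFragment.inter {M : Type*} [L.Structure M] {A p : Set (Fin ny → M)}
    {S : Set (Fin nx → M)} (h : IsFragment φ A p S) {a : Fin ny → M} (ha : a ∈ A) :
    IsFragment φ A p {x ∈ S | rel φ M x a ↔ a ∈ p} := by
  classical
  obtain ⟨A₀, hA₀, h⟩ := h
  refine ⟨insert a A₀, by simp [Set.insert_subset_iff, ha, hA₀], fun b hb => ⟨?_, ?_⟩⟩
  · exact h b fun a' ha' => hb a' (Finset.mem_insert_of_mem ha')
  · exact hb a (Finset.mem_insert_self _ _)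

/-- `θ(x, w) ∧ φ(x, y)`, where `y` is a new tuple of variables. -/
def extend {ι : Type} (θ : L.Formula (Fin nx ⊕ (ι × Fin ny))) (φ : L.Formula (Fin nx ⊕ Fin ny)) :
    L.Formula (Fin nx ⊕ (Option ι × Fin ny)) :=
  θ.relabel (Sum.map id (Prod.map some id)) ⊓ φ.relabel (Sum.map id (Prod.mk none))

lemma solutions_extend {ι : Type} {M : Type*} [L.Structure M]
    (θ : L.Formula (Fin nx ⊕ (ι × Fin ny))) (φ : L.Formula (Fin nx ⊕ Fin ny))
    (w : ι → Fin ny → M) (a : Fin ny → M) :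
    solutions (extend θ φ) (fun o : Option ι => o.elim a w) =
      {x ∈ solutions θ w | rel φ M x a} := by
  ext x
  simp only [solutions, extend, rel, Set.mem_ofPred_eq, Formula.realize_inf,
    Formula.realize_relabel, Sum.elim_comp_map, Function.comp_id]
  rfl

/-- `p` has a fragment of the form `θ(x, w)` with the property `F`. -/
def HasFragment (F : ∀ (M : Type (max u v)) [L.Structure M], Set (Fin nx → M) → Prop)
    (φ : L.Formula (Fin nx ⊕ Fin ny)) {ι : Type} (θ : L.Formula (Fin nx ⊕ (ι × Fin ny)))
    (M : Type (max u v)) [L.Structure M] (A p : Set (Fin ny → M)) : Prop :=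
  ∃ w : ι → Fin ny → M, (∀ i, w i ∈ A) ∧ IsFragment φ A p (solutions θ w) ∧ F M (solutions θ w)

/-- Types having a fragment whose rank and multiplicity cannot be lowered, neither by adding one
more formula nor by requiring more splitting, are uniformly definable. -/
lemma uniformlyDefinable_of_minimal {n : ℕ} (d : ℕ) :
    ∃ q, 2 ≤ q ∧ ∀ {T : L.Theory} {φ : L.Formula (Fin nx ⊕ Fin ny)},
      (∀ (N : Type (max u v)) [L.Structure N] [Nonempty N], N ⊨ T → NoLadder (rel φ N) n) →
      ∀ (m k : ℕ) {ι : Type} [Finite ι] (θ : L.Formula (Fin nx ⊕ (ι × Fin ny))),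
      UniformlyDefinable T φ fun M _ A p => ∃ w : ι → Fin ny → M, (∀ i, w i ∈ A) ∧
        HasPieces (rel φ M) (RankGE (rel φ M) (q * m) k) (d + 1) (solutions θ w) ∧
        ¬ HasPieces (rel φ M) (RankGE (rel φ M) m k) (d + 1 + 1) (solutions θ w) ∧
        ∀ a ∈ A, HasPieces (rel φ M) (RankGE (rel φ M) m k) (d + 1)
          {x ∈ solutions θ w | rel φ M x a ↔ a ∈ p} := by
  obtain ⟨q, hq, hladder⟩ := exists_generic_noLadder n (d + 1)
  refine ⟨q, hq, fun {T φ} hn m k {ι} _ θ => ?_⟩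
  obtain ⟨χ₁, hχ₁⟩ := exists_formula_hasPieces φ (fun M _ => RankGE (rel φ M) (q * m) k)
    (fun M _ _ _ h => RankGE.mono h) (exists_formula_rankGE φ (q * m) k) (d + 1) θ
  obtain ⟨χ₂, hχ₂⟩ := exists_formula_hasPieces φ (fun M _ => RankGE (rel φ M) m k)
    (fun M _ _ _ h => RankGE.mono h) (exists_formula_rankGE φ m k) (d + 1 + 1) θ
  obtain ⟨χ₃, hχ₃⟩ := exists_formula_rankGE φ m k
    (γ := Fin ny ⊕ (ι × Fin ny))
    (θ.relabel (Sum.map id Sum.inr) ⊓ (φ.relabel (Sum.map id Sum.inl)).not)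
  let ψ : L.Formula (Fin ny ⊕ (ι × Fin ny)) :=
    χ₁.relabel Sum.inr ⊓ ((χ₂.relabel Sum.inr).not ⊓ χ₃.not)
  have hψ : ∀ (M : Type (max u v)) [L.Structure M] [Nonempty M] (y : Fin ny → M)
      (w : ι → Fin ny → M), ψ.Realize (Sum.elim y fun iz => w iz.1 iz.2) ↔
        HasPieces (rel φ M) (RankGE (rel φ M) (q * m) k) (d + 1) (solutions θ w) ∧
        ¬ HasPieces (rel φ M) (RankGE (rel φ M) m k) (d + 1 + 1) (solutions θ w) ∧
        ¬ RankGE (rel φ M) m k {x ∈ solutions θ w | ¬ rel φ M x y} := by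
    intro M _ _ y w
    simp only [ψ, Formula.realize_inf, Formula.realize_not, Formula.realize_relabel,
      Sum.elim_comp_inr, hχ₁, hχ₂, hχ₃, Sum.elim_comp_map, Sum.elim_comp_inl, Function.comp_id]
    rfl
  refine ⟨ι, inferInstance, ψ, ⟨q, fun N _ _ hN b a hl => ?_⟩,
    fun M _ _ hM A hA p hp ⟨w, hwA, h₁, h₂, h₃⟩ => ⟨w, hwA, fun a ha => ?_⟩⟩
  · let w (j : Fin q) (i : ι) (s : Fin ny) : N := a j (i, s)
    have hl' := fun i j => (hψ N (b i) (w j)).symm.trans (hl i j)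
    have hj := fun j => (hl' j j).2 le_rfl
    refine hladder (hn N hN) b (fun j => solutions θ (w j)) (fun j => (hj j).1)
      (fun j => (hj j).2.1) fun i j => ?_
    rw [← hl' i j]
    exact ⟨fun h => ⟨(hj j).1, (hj j).2.1, h⟩, fun h => h.2.2⟩
  · rw [hψ]
    have h₃ := h₃ a ha
    constructor
    · rintro ⟨-, -, h⟩
      by_contra hap
      obtain ⟨P, hP, hF, -⟩ := h₃
      exact h ((hF 0).mono fun x hx => by simpa [hap] using hP 0 hx)
    · refine fun hap => ⟨h₁, h₂, fun h => h₂ ?_⟩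
      obtain ⟨P, hP, hF, hs⟩ := h₃
      exact HasPieces.cons (fun i x hx => (hP i hx).1) hF hs (fun x hx => hx.1) h fun i =>
        ⟨a, Or.inr ⟨fun x hx => hx.2, fun x hx => (hP i hx).2.2 hap⟩⟩

lemma uniformlyDefinable_of_not_hasPieces {n : ℕ}
    (hn : ∀ (N : Type (max u v)) [L.Structure N] [Nonempty N], N ⊨ T → NoLadder (rel φ N) n)
    {k : ℕ}
    (hk : ∀ m, 2 ≤ m → ∀ {ι : Type} [Finite ι] (θ : L.Formula (Fin nx ⊕ (ι × Fin ny))),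
      UniformlyDefinable T φ (HasFragment (fun M _ S => ¬ RankGE (rel φ M) m k S) φ θ))
    (d : ℕ) : ∀ m, 2 ≤ m → ∀ {ι : Type} [Finite ι] (θ : L.Formula (Fin nx ⊕ (ι × Fin ny))),
      UniformlyDefinable T φ (HasFragment
        (fun M _ S => ¬ HasPieces (rel φ M) (RankGE (rel φ M) m k) d S) φ θ) := by
  induction d with
  | zero =>
    intro m _ ι _ θ
    refine UniformlyDefinable.of_false fun M _ A p _ ⟨w, _, _, h⟩ => h ?_
    exact ⟨Fin.elim0, fun i => i.elim0, fun i => i.elim0, fun i => i.elim0⟩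
  | succ d ih =>
    intro m hm ι _ θ
    rcases d with _ | d
    · exact (hk m hm θ).of_imp fun M _ A p _ ⟨w, hw, hf, h⟩ =>
        ⟨w, hw, hf, fun h' => h (rankGE_of_hasPieces_one h')⟩
    obtain ⟨q, hq, hmin⟩ := uniformlyDefinable_of_minimal (n := n) (L := L) (nx := nx) (ny := ny) d
    refine (((ih m hm (extend θ φ)).or (ih m hm (extend θ φ.not))).or
      ((ih (q * m) (by nlinarith) θ).or (hmin hn m k θ))).of_imp
      fun M _ A p _ ⟨w, hw, hf, h⟩ => ?_
    by_cases h₁ : HasPieces (rel φ M) (RankGE (rel φ M) (q * m) k) (d + 1) (solutions θ w)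
    · by_cases h₃ : ∀ a ∈ A, HasPieces (rel φ M) (RankGE (rel φ M) m k) (d + 1)
          {x ∈ solutions θ w | rel φ M x a ↔ a ∈ p}
      · exact Or.inr (Or.inr ⟨w, hw, h₁, h, h₃⟩)
      · push Not at h₃
        obtain ⟨a, ha, h₃⟩ := h₃
        have hfa := hf.inter ha
        have hw' : ∀ o : Option ι, o.elim a w ∈ A := fun o => by cases o <;> simp [ha, hw]
        by_cases hap : a ∈ p
        · simp only [hap, iff_true] at h₃ hfa
          exact Or.inl (Or.inl ⟨_, hw', by rwa [solutions_extend], by rwa [solutions_extend]⟩)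
        · have hnot : ∀ x, rel φ.not M x a ↔ ¬ rel φ M x a := fun x => Formula.realize_not
          simp only [hap, iff_false, ← hnot] at h₃ hfa
          exact Or.inl (Or.inr ⟨_, hw', by rwa [solutions_extend], by rwa [solutions_extend]⟩)
    · exact Or.inr (Or.inl ⟨w, hw, hf, h₁⟩)

lemma uniformlyDefinable_of_not_rankGE {n : ℕ}
    (hn : ∀ (N : Type (max u v)) [L.Structure N] [Nonempty N], N ⊨ T → NoLadder (rel φ N) n)
    (k : ℕ) : ∀ m, 2 ≤ m → ∀ {ι : Type} [Finite ι] (θ : L.Formula (Fin nx ⊕ (ι × Fin ny))),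
      UniformlyDefinable T φ (HasFragment (fun M _ S => ¬ RankGE (rel φ M) m k S) φ θ) := by
  induction k with
  | zero =>
    exact fun m _ ι _ θ => UniformlyDefinable.of_false fun M _ A p hp ⟨w, _, hf, h⟩ =>
      h (hf.nonempty hp)
  | succ k ih =>
    exact fun m hm ι _ θ => uniformlyDefinable_of_not_hasPieces hn ih m m hm θ

end Fragments

/-- Uniform definability of `φ`-types for stable `φ`: if `φ(x,y)` is stable in `T` then
there is a single formula `ψ(y, z)`, stable in `T`, with `z` a finite tuple of copies of
`y`, which defines every `φ`-type over every set `A ⊆ M^y` with `|A| ≥ 2` in every model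
`M ⊨ T`, using parameters from `A`. -/
theorem stable_uniform_definability {L : FirstOrder.Language.{u, v}} {nx ny : ℕ}
    (T : L.Theory) (φ : L.Formula (Fin nx ⊕ Fin ny)) (hφ : FormulaStable T φ) :
    ∃ (k : ℕ) (ψ : L.Formula (Fin ny ⊕ (Fin k × Fin ny))),
      FormulaStable T ψ ∧
      ∀ (M : Type (max u v)) [L.Structure M] [Nonempty M], M ⊨ T →
        ∀ A : Set (Fin ny → M), A.Nontrivial →
          ∀ p : Set (Fin ny → M), IsPhiType φ A p →
            ∃ c : Fin k → Fin ny → M, (∀ i, c i ∈ A) ∧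
              ∀ a ∈ A,
                (ψ.Realize (Sum.elim a fun iz => c iz.1 iz.2) ↔ a ∈ p) := by
  obtain ⟨n, hn⟩ := hφ
  have hn' : ∀ (N : Type (max u v)) [L.Structure N] [Nonempty N], N ⊨ T →
      NoLadder (rel φ N) n := fun N _ _ hN => hn N hN
  obtain ⟨ι, hι, ψ, hψ, hdef⟩ :=
    uniformlyDefinable_of_not_rankGE hn' (treeHeight n) 2 le_rfl (ι := Empty) ⊤
  obtain ⟨k, ⟨e⟩⟩ := Finite.exists_equiv_fin ι
  refine ⟨k, _, hψ.relabel (Prod.map e id), fun M _ _ hM A hA p hp => ?_⟩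
  obtain ⟨c, hcA, hc⟩ := hdef M hM A hA p hp
    ⟨Empty.elim, fun i => i.elim, ⟨∅, by simp, fun b _ => by simp [solutions]⟩,
      (hn' M hM).not_rankGE le_rfl _⟩
  refine ⟨c ∘ e.symm, fun i => hcA _, fun a ha => ?_⟩
  rw [← hc a ha, Formula.realize_relabel, Sum.elim_comp_map, Function.comp_id]
  simp [Function.comp_def]
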